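/- Let c be a configuration on the complete graph K_n whose set of distinct values is a₁ < a₂ < … < a_N, where the value a_j is taken by exactly s_j ≥ 1 vertices (so s₁ + ⋯ + s_N = n). If F(F(c)) = c, then a_j − a_{j−1} ≤ s_{j−1} + s_j − 1 for every j with 2 ≤ j ≤ N. -/

import Mathlib

/-- The parallel diffusion firing operator on the complete graph on a finite
vertex type `V`: `F(c)(v) = c(v) + #{u ≠ v : c(u) > c(v)} - #{u ≠ v : c(u) < c(v)}`. -/
def fireK {V : Type*} [Fintype V] [DecidableEq V] (c : V → ℤ) : V → ℤ :=
  fun v =>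
    c v + ((Finset.univ.filter fun u => u ≠ v ∧ c v < c u).card : ℤ)
        - ((Finset.univ.filter fun u => u ≠ v ∧ c u < c v).card : ℤ)

open Finset in
/-- The condition `u ≠ v` in `fireK` is redundant. -/
theorem fireK_apply {V : Type*} [Fintype V] [DecidableEq V] (c : V → ℤ) (v : V) :
    fireK c v = c v + (#{u | c v < c u} : ℤ) - (#{u | c u < c v} : ℤ) := by
  have hup : univ.filter (fun u => u ≠ v ∧ c v < c u) = univ.filter (fun u => c v < c u) := by
    ext u
    simp only [mem_filter_univ, and_iff_right_iff_imp]
    rintro h rfl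
    exact lt_irrefl _ h
  have hdown : univ.filter (fun u => u ≠ v ∧ c u < c v) = univ.filter (fun u => c u < c v) := by
    ext u
    simp only [mem_filter_univ, and_iff_right_iff_imp]
    rintro h rfl
    exact lt_irrefl _ h
  rw [fireK, hup, hdown]

/-- The net number of chips gained is antitone in the value of the vertex. -/
theorem fireK_sub_le_fireK_sub {V : Type*} [Fintype V] [DecidableEq V] (c : V → ℤ) {v w : V}
    (h : c v ≤ c w) : fireK c w - c w ≤ fireK c v - c v := by
  have hup : Finset.card {u | c w < c u} ≤ Finset.card {u | c v < c u} :=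
    Finset.card_le_card (Finset.monotone_filter_right _ fun _ _ hu => h.trans_lt hu)
  have hdown : Finset.card {u | c u < c v} ≤ Finset.card {u | c u < c w} :=
    Finset.card_le_card (Finset.monotone_filter_right _ fun _ _ hu => hu.trans_le h)
  rw [fireK_apply, fireK_apply]
  lia

open Finset in
/-- If no vertex has a value strictly between `c v < c w`, the net gains of `v` and `w` differ by
the number of vertices sharing the value of `v` or of `w`. -/
theorem fireK_sub_eq_of_consecutive {V : Type*} [Fintype V] [DecidableEq V] (c : V → ℤ) {v w : V}
    (h : c v < c w) (hgap : ∀ u, c u ≤ c v ∨ c w ≤ c u) :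
    fireK c v - c v = fireK c w - c w + (#{u | c u = c v} : ℤ) + (#{u | c u = c w} : ℤ) := by
  have hup : #{u | c v < c u} = #{u | c w < c u} + #{u | c u = c w} := by
    rw [← card_union_of_disjoint (disjoint_filter.2 fun u _ h₁ h₂ => by lia), ← filter_or]
    congr 1
    ext u
    have := hgap u
    simp only [mem_filter_univ]
    lia
  have hdown : #{u | c u < c w} = #{u | c u < c v} + #{u | c u = c v} := by
    rw [← card_union_of_disjoint (disjoint_filter.2 fun u _ h₁ h₂ => by lia), ← filter_or]
    congr 1
    ext u
    have := hgap u
    simp only [mem_filter_univ]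
    lia
  rw [fireK_apply, fireK_apply, hup, hdown]
  push_cast
  ring

/-- If the distinct values of a configuration `c` on `K_n` are
`a 0 < a 1 < … < a (N-1)`, with the value `a j` taken by exactly `s j ≥ 1`
vertices, and `F(F(c)) = c`, then every consecutive gap satisfies
`a (j+1) - a j ≤ s j + s (j+1) - 1`. -/
theorem period_small_gaps {n N : ℕ} (a : Fin N → ℤ) (ha : StrictMono a)
    (s : Fin N → ℕ) (hs : ∀ j, 1 ≤ s j) (hsum : ∑ j, s j = n)
    (c : Fin n → ℤ)
    (hvals : ∀ v, ∃ j, c v = a j)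
    (hcount : ∀ j, (Finset.univ.filter fun v => c v = a j).card = s j)
    (hper : fireK (fireK c) = c) :
    ∀ j k : Fin N, (k : ℕ) = (j : ℕ) + 1 →
      a k - a j ≤ (s j : ℤ) + (s k : ℤ) - 1 := by
  intro j k hjk
  have hex (i : Fin N) : ∃ v, c v = a i := by
    obtain ⟨v, hv⟩ := Finset.card_pos.1 ((hs i).trans_eq (hcount i).symm)
    exact ⟨v, (Finset.mem_filter_univ v).1 hv⟩
  obtain ⟨v, hv⟩ := hex j
  obtain ⟨w, hw⟩ := hex k
  have hlt : c v < c w := by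
    rw [hv, hw]
    exact ha (Fin.lt_def.2 (by lia))
  have hgap (u : Fin n) : c u ≤ c v ∨ c w ≤ c u := by
    obtain ⟨i, hi⟩ := hvals u
    rw [hi, hv, hw, ha.le_iff_le, ha.le_iff_le, Fin.le_def, Fin.le_def]
    lia
  have hΔ := fireK_sub_eq_of_consecutive c hlt hgap
  rw [hv, hw, hcount, hcount] at hΔ
  have hj := hs j
  by_contra! hcon
  have hanti := fireK_sub_le_fireK_sub (fireK c) (v := v) (w := w) (by lia)
  rw [hper] at hanti
  lia
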